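/- arXiv:2510.04407 — 4 statements merged into one kernel-verified Lean document; each statement's English description precedes it below -/
import Mathlib

section
/- Run AdOGD on 𝒳 with any positive, nonincreasing learning-rate sequence η^(1) ≥ η^(2) ≥ … ≥ η^(T) > 0. Then the regret satisfies Reg^(T) ≤ D_𝒳²/η^(T) + Σ_{t=1}^T η^(t) ‖u^(t) − m^(t)‖₂² − Σ_{t=1}^T (1/(2η^(t))) ‖x^(t) − x̃^(t)‖₂² − Σ_{t=1}^T (1/(2η^(t))) ‖x^(t) − x̃^(t+1)‖₂². -/
/-- ℓ₂ norm of a vector in ℝ^d. -/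
noncomputable def l2 {d : ℕ} (v : Fin d → ℝ) : ℝ := Real.sqrt (∑ i, (v i) ^ 2)

/-- Standard inner product on ℝ^d. -/
def dotp {d : ℕ} (v w : Fin d → ℝ) : ℝ := ∑ i, v i * w i

theorem l2_sq {d : ℕ} (v : Fin d → ℝ) : l2 v ^ 2 = dotp v v := by
  unfold l2 dotp
  rw [Real.sq_sqrt (Finset.sum_nonneg fun i _ => sq_nonneg _)]
  exact Finset.sum_congr rfl fun i _ => sq _

theorem l2_nonneg {d : ℕ} (v : Fin d → ℝ) : 0 ≤ l2 v := Real.sqrt_nonneg _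

theorem continuous_l2 {d : ℕ} : Continuous (l2 : (Fin d → ℝ) → ℝ) := by
  unfold l2
  fun_prop

theorem dotp_comm {d : ℕ} (v w : Fin d → ℝ) : dotp v w = dotp w v :=
  Finset.sum_congr rfl fun _ _ => mul_comm _ _

theorem dotp_add_left {d : ℕ} (v w z : Fin d → ℝ) : dotp (v + w) z = dotp v z + dotp w z := by
  simp [dotp, add_mul, Finset.sum_add_distrib]

theorem dotp_sub_left {d : ℕ} (v w z : Fin d → ℝ) : dotp (v - w) z = dotp v z - dotp w z := by
  simp [dotp, sub_mul, Finset.sum_sub_distrib]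

theorem dotp_smul_left {d : ℕ} (c : ℝ) (v z : Fin d → ℝ) : dotp (c • v) z = c * dotp v z := by
  simp [dotp, mul_assoc, Finset.mul_sum]

theorem dotp_add_right {d : ℕ} (z v w : Fin d → ℝ) : dotp z (v + w) = dotp z v + dotp z w := by
  simp only [dotp_comm z, dotp_add_left]

theorem dotp_sub_right {d : ℕ} (z v w : Fin d → ℝ) : dotp z (v - w) = dotp z v - dotp z w := by
  simp only [dotp_comm z, dotp_sub_left]

theorem dotp_smul_right {d : ℕ} (c : ℝ) (z v : Fin d → ℝ) : dotp z (c • v) = c * dotp z v := by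
  simp only [dotp_comm z, dotp_smul_left]

theorem dotp_self_nonneg {d : ℕ} (v : Fin d → ℝ) : 0 ≤ dotp v v :=
  l2_sq v ▸ sq_nonneg _

/-- Variational inequality characterizing the closest point of a convex set. -/
theorem dotp_nonneg_of_closest {d : ℕ} {X : Set (Fin d → ℝ)} (hX : Convex ℝ X)
    {p y : Fin d → ℝ} (hp : p ∈ X) (hmin : ∀ w ∈ X, l2 (p - y) ≤ l2 (w - y))
    {w : Fin d → ℝ} (hw : w ∈ X) : 0 ≤ dotp (w - p) (p - y) := by
  by_contra! hc
  set c := dotp (w - p) (p - y) with hc_def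
  set K := dotp (w - p) (w - p) with hK_def
  have hK : 0 ≤ K := dotp_self_nonneg _
  have hKc : 0 < K - c := by linarith
  obtain ⟨s, hs⟩ : ∃ s, s = -c / (K - c) := ⟨_, rfl⟩
  have hs0 : 0 < s := hs ▸ div_pos (by linarith) hKc
  have hs1 : s ≤ 1 := by rw [hs, div_le_one hKc]; linarith
  have hsK : s * (K - c) = -c := by rw [hs]; field_simp
  have hmem : p + s • (w - p) ∈ X := hX.add_smul_sub_mem hp hw ⟨hs0.le, hs1⟩
  have hle := pow_le_pow_left₀ (l2_nonneg _) (hmin _ hmem) 2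
  have hexp : l2 (p + s • (w - p) - y) ^ 2 = l2 (p - y) ^ 2 + s * (2 * c + s * K) := by
    rw [l2_sq, l2_sq, show p + s • (w - p) - y = (p - y) + s • (w - p) by abel,
      dotp_add_left, dotp_add_right, dotp_add_right, dotp_smul_left, dotp_smul_left,
      dotp_smul_right, dotp_smul_right, dotp_comm (p - y) (w - p), ← hc_def, ← hK_def]
    ring
  have hneg : 2 * c + s * K < 0 := by nlinarith
  nlinarith [mul_neg_of_pos_of_neg hs0 hneg]

/-- One-step regret bound for optimistic projected gradient descent. -/
theorem dotp_sub_le_of_optimistic_step {d : ℕ} {X : Set (Fin d → ℝ)} (hX : Convex ℝ X)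
    {η : ℝ} (hη : 0 < η) {u m a b p w : Fin d → ℝ} (hb : b ∈ X)
    (hbmin : ∀ w ∈ X, l2 (b - (a + η • u)) ≤ l2 (w - (a + η • u)))
    (hp : p ∈ X) (hpmin : ∀ w ∈ X, l2 (p - (a + η • m)) ≤ l2 (w - (a + η • m)))
    (hw : w ∈ X) :
    dotp (w - p) u ≤ 1 / (2 * η) * (l2 (w - a) ^ 2 - l2 (w - b) ^ 2) + η * l2 (u - m) ^ 2
      - 1 / (2 * η) * l2 (p - a) ^ 2 - 1 / (2 * η) * l2 (p - b) ^ 2 := by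
  have h1 := dotp_nonneg_of_closest hX hb hbmin hw
  have h2 := dotp_nonneg_of_closest hX hp hpmin hb
  have h3 := dotp_nonneg_of_closest hX hb hbmin hp
  have h4 := dotp_self_nonneg (b - p - η • (u - m))
  have key : 2 * η * dotp (w - p) u ≤ l2 (w - a) ^ 2 - l2 (w - b) ^ 2
      + 2 * η ^ 2 * l2 (u - m) ^ 2 - l2 (p - a) ^ 2 - l2 (p - b) ^ 2 := by
    simp only [l2_sq, dotp_sub_left, dotp_sub_right, dotp_add_right,
      dotp_smul_left, dotp_smul_right] at *
    linarith [dotp_comm u m, dotp_comm a b, dotp_comm a p, dotp_comm a w, dotp_comm b p,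
      dotp_comm b w, dotp_comm p w, congrArg (η * ·) (dotp_comm u b),
      congrArg (η * ·) (dotp_comm u p), congrArg (η * ·) (dotp_comm m b),
      congrArg (η * ·) (dotp_comm m p), congrArg (fun z => η * (η * z)) (dotp_comm u m)]
  have hrw : 1 / (2 * η) * (l2 (w - a) ^ 2 - l2 (w - b) ^ 2) + η * l2 (u - m) ^ 2
      - 1 / (2 * η) * l2 (p - a) ^ 2 - 1 / (2 * η) * l2 (p - b) ^ 2
      = (l2 (w - a) ^ 2 - l2 (w - b) ^ 2
      + 2 * η ^ 2 * l2 (u - m) ^ 2 - l2 (p - a) ^ 2 - l2 (p - b) ^ 2) / (2 * η) := by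
    field_simp
  rw [hrw, le_div_iff₀ (by positivity)]
  linarith

/-- Abel-type bound on a telescoping sum with nondecreasing weights `1 / (2 η t)`. -/
theorem sum_weighted_telescope_le {η f : ℕ → ℝ} {C : ℝ} (hηpos : ∀ t, 1 ≤ t → 0 < η t)
    (hηdec : ∀ t, 1 ≤ t → η (t + 1) ≤ η t) (hf : ∀ t, 1 ≤ t → f t ≤ C)
    {T : ℕ} (hT : 1 ≤ T) :
    ∑ t ∈ Finset.Icc 1 T, 1 / (2 * η t) * (f t - f (t + 1))
      ≤ 1 / (2 * η T) * (C - f (T + 1)) := by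
  induction T, hT using Nat.le_induction with
  | base =>
    have := hηpos 1 le_rfl
    simp only [Finset.Icc_self, Finset.sum_singleton]
    gcongr
    exact hf 1 le_rfl
  | succ n hn ih =>
    rw [Finset.sum_Icc_succ_top (by omega)]
    have h0 := hηpos (n + 1) (by omega)
    have h1 : 1 / (2 * η n) ≤ 1 / (2 * η (n + 1)) := by
      have := hηdec n hn
      gcongr
    have h2 := mul_le_mul_of_nonneg_right h1 (sub_nonneg.2 (hf (n + 1) (by omega)))
    linarith

/-- RVU-type regret bound for AdOGD with any positive nonincreasing
learning-rate sequence.  The projections `x̃^(t+1) = Π_X(x̃^(t) + η^(t) u^(t))`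
and `x^(t) = Π_X(x̃^(t) + η^(t) m^(t))` are encoded by their defining property
(the unique closest point of `X`). -/
theorem stmt2 {d : ℕ} (X : Set (Fin d → ℝ))
    (hXne : X.Nonempty) (hXconv : Convex ℝ X) (hXcomp : IsCompact X)
    (η : ℕ → ℝ) (hηpos : ∀ t, 1 ≤ t → 0 < η t)
    (hηdec : ∀ t, 1 ≤ t → η (t + 1) ≤ η t)
    (u mpred : ℕ → Fin d → ℝ)
    (x xt : ℕ → Fin d → ℝ)
    (hxt1 : xt 1 ∈ X)
    (hxtproj : ∀ t, 1 ≤ t → xt (t + 1) ∈ X ∧ ∀ w ∈ X,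
        l2 (xt (t + 1) - (xt t + η t • u t)) ≤ l2 (w - (xt t + η t • u t)))
    (hxproj : ∀ t, 1 ≤ t → x t ∈ X ∧ ∀ w ∈ X,
        l2 (x t - (xt t + η t • mpred t)) ≤ l2 (w - (xt t + η t • mpred t)))
    (DX : ℝ)
    (hDX : DX = max
        (sSup ((fun p : (Fin d → ℝ) × (Fin d → ℝ) => l2 (p.1 - p.2)) '' (X ×ˢ X)))
        (sSup (l2 '' X)))
    (T : ℕ) (hT : 1 ≤ T) :
    sSup ((fun xs : Fin d → ℝ =>
        ∑ t ∈ Finset.Icc 1 T, dotp (xs - x t) (u t)) '' X)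
      ≤ DX ^ 2 / η T
        + ∑ t ∈ Finset.Icc 1 T, η t * (l2 (u t - mpred t)) ^ 2
        - ∑ t ∈ Finset.Icc 1 T, (1 / (2 * η t)) * (l2 (x t - xt t)) ^ 2
        - ∑ t ∈ Finset.Icc 1 T, (1 / (2 * η t)) * (l2 (x t - xt (t + 1))) ^ 2 := by
  refine csSup_le (hXne.image _) ?_
  rintro _ ⟨w, hw, rfl⟩
  have hxt : ∀ t, 1 ≤ t → xt t ∈ X := fun t ht => by
    obtain rfl | h := ht.eq_or_lt
    · exact hxt1
    · obtain ⟨s, rfl⟩ : ∃ s, t = s + 1 := ⟨t - 1, by omega⟩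
      exact (hxtproj s (by omega)).1
  have hdist : ∀ t, 1 ≤ t → l2 (w - xt t) ^ 2 ≤ DX ^ 2 := fun t ht => by
    refine pow_le_pow_left₀ (l2_nonneg _) ?_ 2
    rw [hDX]
    refine le_max_of_le_left (le_csSup ?_ ⟨(w, xt t), ⟨hw, hxt t ht⟩, rfl⟩)
    exact ((hXcomp.prod hXcomp).image
      (continuous_l2.comp (continuous_fst.sub continuous_snd))).bddAbove
  have htele := sum_weighted_telescope_le (f := fun t => l2 (w - xt t) ^ 2) hηpos hηdec hdist hT
  have hηT := hηpos T hT
  have hlast : 1 / (2 * η T) * (DX ^ 2 - l2 (w - xt (T + 1)) ^ 2) ≤ DX ^ 2 / η T := by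
    rw [one_div_mul_eq_div, div_le_div_iff₀ (by positivity) hηT]
    nlinarith [mul_nonneg hηT.le (sq_nonneg DX), mul_nonneg hηT.le (sq_nonneg (l2 (w - xt (T + 1))))]
  have hstep := Finset.sum_le_sum fun t (ht : t ∈ Finset.Icc 1 T) =>
    have h1 := (Finset.mem_Icc.1 ht).1
    dotp_sub_le_of_optimistic_step hXconv (hηpos t h1) (hxtproj t h1).1 (hxtproj t h1).2
      (hxproj t h1).1 (hxproj t h1).2 hw
  rw [Finset.sum_sub_distrib, Finset.sum_sub_distrib, Finset.sum_add_distrib] at hstep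
  linarith
end

section
/- Run AdOGD on 𝒳 with the adaptive learning rates η^(t) := η/√(P^(t)) for t ≥ 2 and η^(1) := η^(2), where η > 0, P^(t) := Σ_{τ=1}^{t−1} ‖u^(τ) − m^(τ)‖₂², and assume δ := ‖u^(1) − m^(1)‖₂ > 0 and ‖u^(t) − m^(t)‖₂ ≤ B for all t, with B ≥ δ. Then Reg^(T) ≤ (3ηB/δ + D_𝒳²/η) √(Σ_{t=1}^T ‖u^(t) − m^(t)‖₂²) − (δ/(2η)) (Σ_{t=1}^T ‖x^(t) − x̃^(t)‖₂² + Σ_{t=1}^T ‖x^(t) − x̃^(t+1)‖₂²). -/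
/-- Variational inequality for a closest point of a convex set. -/
theorem dotp_sub_le_zero_of_closest {d : ℕ} {X : Set (Fin d → ℝ)} (hX : Convex ℝ X)
    {p y w : Fin d → ℝ} (hy : y ∈ X) (hmin : ∀ w ∈ X, l2 (y - p) ≤ l2 (w - p)) (hw : w ∈ X) :
    dotp (w - y) (p - y) ≤ 0 := by
  by_contra! hg
  set g := dotp (w - y) (p - y) with hgdef
  have hn : 0 ≤ l2 (w - y) ^ 2 := sq_nonneg _
  set n := l2 (w - y) ^ 2 with hndef
  have hgn : 0 < g + n := by linarith
  set a := g / (g + n) with hadef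
  have ha : 0 < a := by positivity
  have ha1 : a ≤ 1 := by
    rw [hadef, div_le_one hgn]
    linarith
  have hmem : y + a • (w - y) ∈ X := hX.add_smul_sub_mem hy hw ⟨ha.le, ha1⟩
  have hle := pow_le_pow_left₀ (l2_nonneg _) (hmin _ hmem) 2
  have hexpand : l2 (y + a • (w - y) - p) ^ 2 = l2 (y - p) ^ 2 - 2 * a * g + a ^ 2 * n := by
    rw [hndef, hgdef, l2_sq, l2_sq, l2_sq]
    simp only [dotp, Finset.mul_sum, ← Finset.sum_add_distrib, ← Finset.sum_sub_distrib]
    refine Finset.sum_congr rfl fun i _ => ?_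
    simp only [Pi.add_apply, Pi.sub_apply, Pi.smul_apply, smul_eq_mul]
    ring
  have hagn : a * (g + n) = g := div_mul_cancel₀ _ hgn.ne'
  nlinarith [mul_pos ha ha, mul_pos ha hg, mul_pos (mul_pos ha ha) hg]

/-- One step of optimistic gradient descent. -/
theorem optimistic_step {d : ℕ} {X : Set (Fin d → ℝ)} (hX : Convex ℝ X)
    {u m z z' y c : Fin d → ℝ} {s : ℝ} (hs : 0 < s) (hz' : z' ∈ X) (hy : y ∈ X) (hc : c ∈ X)
    (hz'min : ∀ w ∈ X, l2 (z' - (z + s • u)) ≤ l2 (w - (z + s • u)))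
    (hymin : ∀ w ∈ X, l2 (y - (z + s • m)) ≤ l2 (w - (z + s • m))) :
    dotp (c - y) u ≤ s⁻¹ / 2 * (l2 (c - z) ^ 2 - l2 (c - z') ^ 2
      - (l2 (y - z) ^ 2 + l2 (y - z') ^ 2)) + s * l2 (u - m) ^ 2 := by
  have h1 := dotp_sub_le_zero_of_closest hX hz' hz'min hc
  have h2 := dotp_sub_le_zero_of_closest hX hy hymin hz'
  have h3 := dotp_sub_le_zero_of_closest hX hz' hz'min hy
  have h4 : 0 ≤ l2 (s • (u - m) - (z' - y)) ^ 2 := sq_nonneg _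
  have key : 2 * s * dotp (c - y) u = l2 (c - z) ^ 2 - l2 (c - z') ^ 2
      - (l2 (y - z) ^ 2 + l2 (y - z') ^ 2) + 2 * s ^ 2 * l2 (u - m) ^ 2
      + 2 * dotp (c - z') (z + s • u - z') + 4 * dotp (z' - y) (z + s • m - y)
      + 2 * dotp (y - z') (z + s • u - z') - 2 * l2 (s • (u - m) - (z' - y)) ^ 2 := by
    simp only [l2_sq]
    simp only [dotp, Finset.mul_sum, ← Finset.sum_add_distrib, ← Finset.sum_sub_distrib]
    refine Finset.sum_congr rfl fun i _ => ?_
    simp only [Pi.add_apply, Pi.sub_apply, Pi.smul_apply, smul_eq_mul]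
    ring
  have h5 : dotp (c - y) u = s⁻¹ / 2 * (2 * s * dotp (c - y) u) := by
    field_simp
  have h6 : s⁻¹ / 2 * (2 * s ^ 2 * l2 (u - m) ^ 2) = s * l2 (u - m) ^ 2 := by
    field_simp
  rw [h5, ← h6, ← mul_add]
  exact mul_le_mul_of_nonneg_left (by linarith) (by positivity)

theorem div_sqrt_le_sub_sqrt {p e B δ : ℝ} (hδ : 0 < δ) (hB : δ ≤ B) (hp : δ ^ 2 ≤ p)
    (he : 0 ≤ e) (heB : e ≤ B) :
    e ^ 2 / √p ≤ 3 * (B / δ) * (√(p + e ^ 2) - √p) := by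
  have hδp : δ ≤ √p := Real.le_sqrt_of_sq_le hp
  have hp0 : 0 ≤ p := (sq_nonneg δ).trans hp
  have hr2 : √p ^ 2 = p := Real.sq_sqrt hp0
  have hs2 : √(p + e ^ 2) ^ 2 = p + e ^ 2 := Real.sq_sqrt (by positivity)
  have hrs : √p ≤ √(p + e ^ 2) := Real.sqrt_le_sqrt (by nlinarith)
  set r := √p
  set s := √(p + e ^ 2)
  have hr : 0 < r := hδ.trans_le hδp
  have hk : 1 ≤ B / δ := (one_le_div hδ).2 hB
  set k := B / δ with hkdef
  have hBk : B = k * δ := by rw [hkdef]; field_simp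
  have hBr : e ≤ k * r := heB.trans (by rw [hBk]; gcongr)
  have hs : s ≤ (3 * k - 1) * r := by
    refine abs_le_of_sq_le_sq' ?_ (by nlinarith) |>.2
    have := pow_le_pow_left₀ he hBr 2
    nlinarith [mul_nonneg (sub_nonneg.2 hk) (sq_nonneg r), mul_nonneg (mul_nonneg (sub_nonneg.2 hk)
      (sub_nonneg.2 hk)) (sq_nonneg r)]
  rw [div_le_iff₀ hr]
  have : e ^ 2 = (s - r) * (s + r) := by linarith
  rw [this]
  nlinarith [mul_le_mul_of_nonneg_left hs (sub_nonneg.2 hrs)]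

/-- modified RVU-type regret bound for AdOGD with the adaptive
learning rates `η^(t) = η / √(P^(t))` (for `t ≥ 2`, and `η^(1) = η^(2)`), where
`P^(t) = ∑_{τ=1}^{t-1} ‖u^(τ) - m^(τ)‖₂²`.  Projections are encoded by their
defining property (closest point of `X`). -/
theorem stmt3 {d : ℕ} (X : Set (Fin d → ℝ))
    (hXne : X.Nonempty) (hXconv : Convex ℝ X) (hXcomp : IsCompact X)
    (u mpred : ℕ → Fin d → ℝ)
    (ηc : ℝ) (hηc : 0 < ηc)
    (P : ℕ → ℝ)
    (hP : ∀ t, P t = ∑ τ ∈ Finset.Icc 1 (t - 1), (l2 (u τ - mpred τ)) ^ 2)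
    (η : ℕ → ℝ)
    (hη : ∀ t, 2 ≤ t → η t = ηc / Real.sqrt (P t)) (hη1 : η 1 = η 2)
    (δ : ℝ) (hδdef : δ = l2 (u 1 - mpred 1)) (hδpos : 0 < δ)
    (B : ℝ) (hB : δ ≤ B)
    (hBbound : ∀ t, 1 ≤ t → l2 (u t - mpred t) ≤ B)
    (x xt : ℕ → Fin d → ℝ)
    (hxt1 : xt 1 ∈ X)
    (hxtproj : ∀ t, 1 ≤ t → xt (t + 1) ∈ X ∧ ∀ w ∈ X,
        l2 (xt (t + 1) - (xt t + η t • u t)) ≤ l2 (w - (xt t + η t • u t)))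
    (hxproj : ∀ t, 1 ≤ t → x t ∈ X ∧ ∀ w ∈ X,
        l2 (x t - (xt t + η t • mpred t)) ≤ l2 (w - (xt t + η t • mpred t)))
    (DX : ℝ)
    (hDX : DX = max
        (sSup ((fun p : (Fin d → ℝ) × (Fin d → ℝ) => l2 (p.1 - p.2)) '' (X ×ˢ X)))
        (sSup (l2 '' X)))
    (T : ℕ) (hT : 1 ≤ T) :
    sSup ((fun xs : Fin d → ℝ =>
        ∑ t ∈ Finset.Icc 1 T, dotp (xs - x t) (u t)) '' X)
      ≤ (3 * ηc * B / δ + DX ^ 2 / ηc)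
          * Real.sqrt (∑ t ∈ Finset.Icc 1 T, (l2 (u t - mpred t)) ^ 2)
        - (δ / (2 * ηc)) *
            ((∑ t ∈ Finset.Icc 1 T, (l2 (x t - xt t)) ^ 2)
              + ∑ t ∈ Finset.Icc 1 T, (l2 (x t - xt (t + 1))) ^ 2) := by
  have hDX0 : ∀ c ∈ X, ∀ z ∈ X, l2 (c - z) ^ 2 ≤ DX ^ 2 := by
    intro c hc z hz
    refine pow_le_pow_left₀ (l2_nonneg _) ?_ 2
    rw [hDX]
    refine le_max_of_le_left (le_csSup ?_ ⟨(c, z), ⟨hc, hz⟩, rfl⟩)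
    exact ((hXcomp.prod hXcomp).image
      (continuous_l2.comp (continuous_fst.sub continuous_snd))).bddAbove
  have hPsucc : ∀ t, 1 ≤ t → P (t + 1) = P t + l2 (u t - mpred t) ^ 2 := by
    intro t ht
    obtain ⟨k, rfl⟩ := Nat.exists_eq_add_of_le' ht
    rw [hP, hP, Nat.add_sub_cancel, Nat.add_sub_cancel, Finset.sum_Icc_succ_top (by omega)]
  have hP2 : P 2 = δ ^ 2 := by
    rw [hP, hδdef]
    simp
  have hPδ : ∀ t, 2 ≤ t → δ ^ 2 ≤ P t := by
    intro t ht
    induction t, ht using Nat.le_induction with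
    | base => exact hP2.ge
    | succ t ht ih =>
      rw [hPsucc t (by omega)]
      exact ih.trans (le_add_of_nonneg_right (sq_nonneg _))
  have hPpos : ∀ t, 2 ≤ t → 0 < √(P t) := fun t ht =>
    Real.sqrt_pos.2 ((pow_pos hδpos 2).trans_le (hPδ t ht))
  have hsqrt2 : √(P 2) = δ := by rw [hP2, Real.sqrt_sq hδpos.le]
  have hηinv : ∀ t, 2 ≤ t → (η t)⁻¹ = √(P t) / ηc := fun t ht => by rw [hη t ht, inv_div]
  have hηpos : ∀ t, 1 ≤ t → 0 < η t := by
    intro t ht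
    rcases ht.eq_or_lt with rfl | ht
    · rw [hη1, hη 2 le_rfl]
      exact div_pos hηc (hPpos 2 le_rfl)
    · rw [hη t ht]
      exact div_pos hηc (hPpos t ht)
  have hηδ : ∀ t, 1 ≤ t → δ / ηc ≤ (η t)⁻¹ := by
    intro t ht
    rcases ht.eq_or_lt with rfl | ht
    · rw [hη1, hηinv 2 le_rfl, hsqrt2]
    · rw [hηinv t ht]
      gcongr
      exact Real.le_sqrt_of_sq_le (hPδ t ht)
  have hηmono : ∀ t, 1 ≤ t → (η t)⁻¹ ≤ (η (t + 1))⁻¹ := by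
    intro t ht
    rcases ht.eq_or_lt with rfl | ht
    · rw [hη1]
    · rw [hηinv t ht, hηinv (t + 1) (by omega), hPsucc t (by omega)]
      gcongr
      exact le_add_of_nonneg_right (sq_nonneg _)
  have hηP : ∀ t, 1 ≤ t → (η t)⁻¹ ≤ √(P (t + 1)) / ηc := by
    intro t ht
    rw [← hηinv (t + 1) (by omega)]
    exact hηmono t ht
  have hxtX : ∀ t, 1 ≤ t → xt t ∈ X := by
    intro t ht
    rcases ht.eq_or_lt with rfl | ht
    · exact hxt1
    · obtain ⟨k, rfl⟩ := Nat.exists_eq_add_of_le' ht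
      exact (hxtproj (k + 1) (by omega)).1
  have hstep : ∀ c ∈ X, ∀ t, 1 ≤ t → dotp (c - x t) (u t) ≤
      (η t)⁻¹ / 2 * (l2 (c - xt t) ^ 2 - l2 (c - xt (t + 1)) ^ 2)
      - δ / (2 * ηc) * (l2 (x t - xt t) ^ 2 + l2 (x t - xt (t + 1)) ^ 2)
      + η t * l2 (u t - mpred t) ^ 2 := by
    intro c hc t ht
    have h := optimistic_step hXconv (hηpos t ht) (hxtproj t ht).1 (hxproj t ht).1 hc
      (hxtproj t ht).2 (hxproj t ht).2
    have h' : δ / (2 * ηc) * (l2 (x t - xt t) ^ 2 + l2 (x t - xt (t + 1)) ^ 2) ≤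
        (η t)⁻¹ / 2 * (l2 (x t - xt t) ^ 2 + l2 (x t - xt (t + 1)) ^ 2) := by
      refine mul_le_mul_of_nonneg_right ?_ (by positivity)
      have := hηδ t ht
      rw [mul_comm, ← div_div]
      linarith
    linarith
  have hsum : ∀ c ∈ X, ∀ n, 1 ≤ n →
      ∑ t ∈ Finset.Icc 1 n, dotp (c - x t) (u t) + (η n)⁻¹ / 2 * l2 (c - xt (n + 1)) ^ 2
        + δ / (2 * ηc) * ((∑ t ∈ Finset.Icc 1 n, (l2 (x t - xt t)) ^ 2)
          + ∑ t ∈ Finset.Icc 1 n, (l2 (x t - xt (t + 1))) ^ 2)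
      ≤ (η n)⁻¹ / 2 * DX ^ 2 + 3 * ηc * B / δ * √(P (n + 1)) := by
    intro c hc n hn
    induction n, hn using Nat.le_induction with
    | base =>
      have h := hstep c hc 1 le_rfl
      have hd := mul_le_mul_of_nonneg_left (hDX0 c hc _ hxt1)
        (half_pos (inv_pos.2 (hηpos 1 le_rfl))).le
      have he : η 1 * l2 (u 1 - mpred 1) ^ 2 ≤ 3 * ηc * B / δ * √(P (1 + 1)) := by
        rw [← hδdef, hη1, hη 2 le_rfl, hsqrt2, div_mul_cancel₀ _ hδpos.ne']
        have : ηc / δ * δ ^ 2 = ηc * δ := by field_simp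
        rw [this]
        nlinarith
      simp only [Finset.Icc_self, Finset.sum_singleton]
      linarith
    | succ n hn ih =>
      have h := hstep c hc (n + 1) (by omega)
      have hd := mul_le_mul_of_nonneg_left (hDX0 c hc _ (hxtX (n + 1) (by omega)))
        (half_pos (inv_pos.2 (hηpos n hn))).le
      have hd' := mul_le_mul_of_nonneg_left (hDX0 c hc _ (hxtX (n + 1) (by omega)))
        (sub_nonneg.2 (hηmono n hn))
      have he : η (n + 1) * l2 (u (n + 1) - mpred (n + 1)) ^ 2 ≤
          3 * ηc * B / δ * (√(P (n + 1 + 1)) - √(P (n + 1))) := by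
        rw [hη (n + 1) (by omega), hPsucc (n + 1) (by omega)]
        have := mul_le_mul_of_nonneg_left (div_sqrt_le_sub_sqrt hδpos hB (hPδ (n + 1) (by omega))
          (l2_nonneg _) (hBbound (n + 1) (by omega))) hηc.le
        calc _ = _ := by ring
          _ ≤ _ := this
          _ = _ := by ring
      simp only [Finset.sum_Icc_succ_top (show 1 ≤ n + 1 by omega)]
      linarith
  refine csSup_le (hXne.image _) ?_
  rintro _ ⟨c, hc, rfl⟩
  have h := hsum c hc T hT
  have hPT : P (T + 1) = ∑ t ∈ Finset.Icc 1 T, (l2 (u t - mpred t)) ^ 2 := by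
    rw [hP, Nat.add_sub_cancel]
  rw [← hPT]
  have h1 : 0 ≤ (η T)⁻¹ / 2 * l2 (c - xt (T + 1)) ^ 2 :=
    mul_nonneg (half_pos (inv_pos.2 (hηpos T hT))).le (sq_nonneg _)
  have h2 : (η T)⁻¹ / 2 * DX ^ 2 ≤ DX ^ 2 / ηc * √(P (T + 1)) := by
    have h3 := mul_le_mul_of_nonneg_right (hηP T hT) (sq_nonneg DX)
    have h4 : 0 ≤ (η T)⁻¹ * DX ^ 2 := mul_nonneg (inv_pos.2 (hηpos T hT)).le (sq_nonneg _)
    have h5 : √(P (T + 1)) / ηc * DX ^ 2 = DX ^ 2 / ηc * √(P (T + 1)) := by ring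
    linarith
  rw [add_mul]
  show ∑ t ∈ Finset.Icc 1 T, dotp (c - x t) (u t) ≤ _
  linarith
end

section
/- In self-play AdOGD on a zero-sum game with predictions m^(t) := u^(t−1) for t ≥ 2 and m^(1) := 0 for each player, and with δ_𝒳 := ‖u_𝒳^(1)‖₂ > 0 and δ_𝒴 := ‖u_𝒴^(1)‖₂ > 0, there exists a constant C ≥ 0 independent of T such that for every T ≥ 1 there is an iterate t ∈ {1, …, T} for which the duality gap of (x^(t), y^(t)) is at most C/√T. -/
open Matrix

open scoped InnerProductSpace

section Projection

variable {E : Type*} [NormedAddCommGroup E] [InnerProductSpace ℝ E]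

/-- The variational inequality satisfied by a closest point of a convex set. -/
lemma inner_sub_le_zero_of_closest {K : Set E} (hK : Convex ℝ K) {p q : E} (hp : p ∈ K)
    (h : ∀ w ∈ K, ‖p - q‖ ≤ ‖w - q‖) {w : E} (hw : w ∈ K) : ⟪q - p, w - p⟫_ℝ ≤ 0 := by
  refine (norm_eq_iInf_iff_real_inner_le_zero hK hp).1 ?_ w hw
  have : Nonempty K := ⟨⟨p, hp⟩⟩
  refine le_antisymm (le_ciInf fun v => ?_)
    (ciInf_le ⟨0, by rintro _ ⟨v, rfl⟩; exact norm_nonneg _⟩ (⟨p, hp⟩ : K))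
  rw [norm_sub_rev q, norm_sub_rev q]
  exact h v v.2

/-- One-step regret bound for optimistic gradient ascent. -/
lemma inner_le_of_optimistic_step {η : ℝ} (hη : 0 < η) {z x z' u m w : E}
    (hz : ⟪z + η • u - z', w - z'⟫_ℝ ≤ 0) (hx : ⟪z + η • m - x, z' - x⟫_ℝ ≤ 0) :
    ⟪u, w - x⟫_ℝ ≤ η⁻¹ * (‖z - w‖ ^ 2 - ‖z' - w‖ ^ 2) / 2 + η * ‖u - m‖ ^ 2
      - η⁻¹ * (‖x - z‖ ^ 2 + ‖z' - x‖ ^ 2) / 4 := by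
  have key : η * ⟪u, w - x⟫_ℝ ≤ (‖z - w‖ ^ 2 - ‖z' - w‖ ^ 2) / 2 + η ^ 2 * ‖u - m‖ ^ 2
      - (‖x - z‖ ^ 2 + ‖z' - x‖ ^ 2) / 4 := by
    have h1 : 0 ≤ ‖(2 * η) • (u - m) - (z' - x)‖ ^ 2 := sq_nonneg _
    have h2 : 0 ≤ ‖x - z‖ ^ 2 := sq_nonneg _
    simp only [← real_inner_self_eq_norm_sq, inner_sub_left, inner_sub_right, inner_add_left,
      real_inner_smul_left, real_inner_smul_right] at *
    have c1 := real_inner_comm z x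
    have c2 := real_inner_comm z z'
    have c3 := real_inner_comm z w
    have c4 := real_inner_comm x z'
    have c5 := real_inner_comm z' w
    have c6 := real_inner_comm u m
    have c7 := real_inner_comm u x
    have c8 := real_inner_comm u z'
    have c9 := real_inner_comm m x
    have c10 := real_inner_comm m z'
    simp only [c1, c2, c3, c4, c5, c6, c7, c8, c9, c10] at *
    nlinarith
  have := mul_le_mul_of_nonneg_left key (inv_nonneg.2 hη.le)
  calc ⟪u, w - x⟫_ℝ = η⁻¹ * (η * ⟪u, w - x⟫_ℝ) := by field_simp
    _ ≤ _ := this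
    _ = _ := by field_simp

end Projection

/-- Summation by parts against nondecreasing weights. -/
lemma sum_mul_sub_le {r d : ℕ → ℝ} {B : ℝ} (hr : ∀ t, 1 ≤ t → r t ≤ r (t + 1))
    (hr1 : 0 ≤ r 1) (hd : ∀ t, 1 ≤ t → 0 ≤ d t ∧ d t ≤ B) {T : ℕ} (hT : 1 ≤ T) :
    ∑ t ∈ Finset.Icc 1 T, r t * (d t - d (t + 1)) ≤ r T * (B - d (T + 1)) := by
  induction T, hT using Nat.le_induction with
  | base => simpa using mul_le_mul_of_nonneg_left (sub_le_sub_right (hd 1 le_rfl).2 _) hr1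
  | succ T hT ih =>
    rw [Finset.sum_Icc_succ_top (by omega)]
    nlinarith [hr T hT, hd (T + 1) (by omega)]

/-- A run of optimistic gradient ascent on `K` with utilities `u`, predictions `m` and adaptive
rates `η t = c / √(P t)`, where `z` are the secondary iterates. -/
structure AdaptiveRun {E : Type*} [NormedAddCommGroup E] [InnerProductSpace ℝ E] (K : Set E)
    (D G c δ : ℝ) (x z u m : ℕ → E) (P η : ℕ → ℝ) : Prop where
  diam : ∀ v ∈ K, ∀ w ∈ K, ‖v - w‖ ≤ D
  norm_u : ∀ t, 1 ≤ t → ‖u t‖ ≤ G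
  norm_m : ∀ t, 1 ≤ t → ‖m t‖ ≤ G
  c_pos : 0 < c
  δ_pos : 0 < δ
  x_mem : ∀ t, 1 ≤ t → x t ∈ K
  z_mem : ∀ t, 1 ≤ t → z t ∈ K
  z_step : ∀ t, 1 ≤ t → ∀ w ∈ K, ⟪z t + η t • u t - z (t + 1), w - z (t + 1)⟫_ℝ ≤ 0
  x_step : ∀ t, 1 ≤ t → ∀ w ∈ K, ⟪z t + η t • m t - x t, w - x t⟫_ℝ ≤ 0
  P_two : P 2 = δ ^ 2
  P_succ : ∀ t, 1 ≤ t → P (t + 1) = P t + ‖u t - m t‖ ^ 2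
  rate : ∀ t, 2 ≤ t → η t = c / √(P t)
  rate_one : η 1 = η 2

/-- The second-order movement of a run at time `t`. -/
def movement {E : Type*} [NormedAddCommGroup E] (x z : ℕ → E) (t : ℕ) : ℝ :=
  ‖x t - z t‖ ^ 2 + ‖z (t + 1) - x t‖ ^ 2

lemma movement_nonneg {E : Type*} [NormedAddCommGroup E] (x z : ℕ → E) (t : ℕ) :
    0 ≤ movement x z t := by unfold movement; positivity

namespace AdaptiveRun

variable {E : Type*} [NormedAddCommGroup E] [InnerProductSpace ℝ E] {K : Set E}
  {D G c δ : ℝ} {x z u m : ℕ → E} {P η : ℕ → ℝ}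

lemma D_nonneg (h : AdaptiveRun K D G c δ x z u m P η) : 0 ≤ D :=
  (norm_nonneg _).trans (h.diam _ (h.x_mem 1 le_rfl) _ (h.x_mem 1 le_rfl))

lemma G_nonneg (h : AdaptiveRun K D G c δ x z u m P η) : 0 ≤ G :=
  (norm_nonneg _).trans (h.norm_u 1 le_rfl)

lemma P_mono (h : AdaptiveRun K D G c δ x z u m P η) {t : ℕ} (ht : 1 ≤ t) : P t ≤ P (t + 1) := by
  rw [h.P_succ t ht]; nlinarith [sq_nonneg ‖u t - m t‖]

lemma sq_le_P (h : AdaptiveRun K D G c δ x z u m P η) {t : ℕ} (ht : 2 ≤ t) : δ ^ 2 ≤ P t := by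
  induction t, ht using Nat.le_induction with
  | base => exact h.P_two.ge
  | succ t ht ih => exact ih.trans (h.P_mono (by omega))

lemma le_sqrt_P (h : AdaptiveRun K D G c δ x z u m P η) {t : ℕ} (ht : 2 ≤ t) : δ ≤ √(P t) :=
  Real.le_sqrt_of_sq_le (h.sq_le_P ht)

lemma inv_rate (h : AdaptiveRun K D G c δ x z u m P η) {t : ℕ} (ht : 2 ≤ t) :
    (η t)⁻¹ = √(P t) / c := by rw [h.rate t ht, inv_div]

lemma inv_rate_mono (h : AdaptiveRun K D G c δ x z u m P η) {t : ℕ} (ht : 1 ≤ t) :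
    (η t)⁻¹ ≤ (η (t + 1))⁻¹ := by
  rcases ht.eq_or_lt with rfl | ht
  · rw [h.rate_one]
  · rw [h.inv_rate ht, h.inv_rate (by omega)]
    exact div_le_div_of_nonneg_right (Real.sqrt_le_sqrt (h.P_mono (by omega))) h.c_pos.le

lemma inv_rate_le (h : AdaptiveRun K D G c δ x z u m P η) {t : ℕ} (ht : 1 ≤ t) :
    (η t)⁻¹ ≤ √(P (t + 1)) / c :=
  (h.inv_rate_mono ht).trans (h.inv_rate (by omega)).le

lemma le_inv_rate (h : AdaptiveRun K D G c δ x z u m P η) {t : ℕ} (ht : 1 ≤ t) :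
    δ / c ≤ (η t)⁻¹ := by
  rcases ht.eq_or_lt with rfl | ht
  · rw [h.rate_one, h.inv_rate le_rfl]
    exact div_le_div_of_nonneg_right (h.le_sqrt_P le_rfl) h.c_pos.le
  · rw [h.inv_rate ht]
    exact div_le_div_of_nonneg_right (h.le_sqrt_P ht) h.c_pos.le

lemma rate_pos (h : AdaptiveRun K D G c δ x z u m P η) {t : ℕ} (ht : 1 ≤ t) : 0 < η t :=
  inv_pos.1 ((div_pos h.δ_pos h.c_pos).trans_le (h.le_inv_rate ht))

lemma norm_sub_le (h : AdaptiveRun K D G c δ x z u m P η) {t : ℕ} (ht : 1 ≤ t) :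
    ‖u t - m t‖ ≤ 2 * G := by
  linarith [_root_.norm_sub_le (u t) (m t), h.norm_u t ht, h.norm_m t ht]

/-- The accumulated weighted prediction errors are of order `√P`. -/
lemma sum_rate_mul_le (h : AdaptiveRun K D G c δ x z u m P η) (hP : 0 ≤ P 1) {T : ℕ}
    (hT : 1 ≤ T) :
    ∑ t ∈ Finset.Icc 1 T, η t * ‖u t - m t‖ ^ 2 ≤ c * (2 + 2 * G / δ) * √(P (T + 1)) := by
  have hc := h.c_pos
  have hδ := h.δ_pos
  have hG := h.G_nonneg
  induction T, hT using Nat.le_induction with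
  | base =>
    have h2 : √(P 2) = δ := by rw [h.P_two, Real.sqrt_sq hδ.le]
    have ha : ‖u 1 - m 1‖ ^ 2 ≤ δ ^ 2 := by
      have := h.P_succ 1 le_rfl
      rw [h.P_two] at this
      linarith
    rw [Finset.Icc_self, Finset.sum_singleton, h.rate_one, h.rate 2 le_rfl, h2]
    calc c / δ * ‖u 1 - m 1‖ ^ 2 ≤ c / δ * δ ^ 2 := by gcongr
      _ = c * 1 * δ := by field_simp
      _ ≤ c * (2 + 2 * G / δ) * δ := by
        have : 0 ≤ 2 * G / δ := by positivity
        gcongr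
        linarith
  | succ T hT ih =>
    rw [Finset.sum_Icc_succ_top (by omega)]
    set s := √(P (T + 1)) with hs
    set s' := √(P (T + 1 + 1)) with hs'
    have hsδ : δ ≤ s := h.le_sqrt_P (by omega)
    have hs0 : 0 < s := hδ.trans_le hsδ
    have hss : s ≤ s' := Real.sqrt_le_sqrt (h.P_mono (by omega))
    have hPs : P (T + 1) = s ^ 2 :=
      (Real.sq_sqrt ((sq_nonneg δ).trans (h.sq_le_P (by omega)))).symm
    have hPs' : P (T + 1 + 1) = s' ^ 2 :=
      (Real.sq_sqrt ((sq_nonneg δ).trans (h.sq_le_P (by omega)))).symm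
    have ha : ‖u (T + 1) - m (T + 1)‖ ^ 2 = (s' - s) * (s' + s) := by
      have := h.P_succ (T + 1) (by omega)
      rw [hPs, hPs'] at this
      linarith
    have haG := h.norm_sub_le (t := T + 1) (by omega)
    have hs'G : s' ≤ s + 2 * G := by
      refine le_of_sq_le_sq ?_ (by positivity)
      nlinarith [pow_le_pow_left₀ (norm_nonneg _) haG 2, mul_nonneg hs0.le hG]
    have hsum : s' + s ≤ (2 + 2 * G / δ) * s := by
      have : 2 * G ≤ 2 * G / δ * s := by
        rw [div_mul_eq_mul_div, le_div_iff₀ hδ]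
        gcongr
      linarith
    have hstep : η (T + 1) * ‖u (T + 1) - m (T + 1)‖ ^ 2 ≤ c * (2 + 2 * G / δ) * (s' - s) := by
      rw [h.rate (T + 1) (by omega), ha, ← hs]
      calc c / s * ((s' - s) * (s' + s))
          ≤ c / s * ((s' - s) * ((2 + 2 * G / δ) * s)) := by
            have := sub_nonneg.2 hss
            gcongr
        _ = _ := by field_simp
    linarith

/-- The regret of a run against a fixed comparator. -/
lemma regret_le (h : AdaptiveRun K D G c δ x z u m P η) (hP : 0 ≤ P 1) {w : E} (hw : w ∈ K)
    {T : ℕ} (hT : 1 ≤ T) :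
    ∑ t ∈ Finset.Icc 1 T, ⟪u t, w - x t⟫_ℝ ≤
      (D ^ 2 / (2 * c) + c * (2 + 2 * G / δ)) * √(P (T + 1))
        - δ / c / 4 * ∑ t ∈ Finset.Icc 1 T, movement x z t := by
  have hstep : ∀ t ∈ Finset.Icc 1 T, ⟪u t, w - x t⟫_ℝ ≤
      (η t)⁻¹ * (‖z t - w‖ ^ 2 - ‖z (t + 1) - w‖ ^ 2) / 2 + η t * ‖u t - m t‖ ^ 2
        - δ / c / 4 * movement x z t := by
    intro t ht
    have ht := (Finset.mem_Icc.1 ht).1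
    refine (inner_le_of_optimistic_step (h.rate_pos ht) (h.z_step t ht w hw)
      (h.x_step t ht _ (h.z_mem (t + 1) (by omega)))).trans ?_
    have := mul_le_mul_of_nonneg_right (h.le_inv_rate ht) (movement_nonneg x z t)
    unfold movement at *
    linarith
  refine (Finset.sum_le_sum hstep).trans ?_
  rw [Finset.sum_sub_distrib, Finset.sum_add_distrib, ← Finset.sum_div, ← Finset.mul_sum]
  have h1 := sum_mul_sub_le (r := fun t => (η t)⁻¹) (d := fun t => ‖z t - w‖ ^ 2) (B := D ^ 2)
    (fun t ht => h.inv_rate_mono ht) (inv_nonneg.2 (h.rate_pos le_rfl).le)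
    (fun t ht => ⟨sq_nonneg _,
      pow_le_pow_left₀ (norm_nonneg _) (h.diam _ (h.z_mem t ht) w hw) 2⟩) hT
  have h2 : (η T)⁻¹ * (D ^ 2 - ‖z (T + 1) - w‖ ^ 2) ≤ √(P (T + 1)) / c * D ^ 2 := by
    have hr := inv_nonneg.2 (h.rate_pos hT).le
    have hb := mul_le_mul_of_nonneg_right (h.inv_rate_le hT) (sq_nonneg D)
    have := mul_nonneg hr (sq_nonneg ‖z (T + 1) - w‖)
    linarith
  have h3 := h.sum_rate_mul_le hP hT
  have h4 : √(P (T + 1)) / c * D ^ 2 / 2 = D ^ 2 / (2 * c) * √(P (T + 1)) := by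
    have := h.c_pos.ne'
    field_simp
  linarith

/-- The suboptimality of a single iterate is controlled by its movement. -/
lemma inner_le_movement (h : AdaptiveRun K D G c δ x z u m P η) {w : E} (hw : w ∈ K) {t : ℕ}
    (ht : 1 ≤ t) :
    ⟪u t, w - x t⟫_ℝ ≤ (√(P (t + 1)) / c * (2 * D) + G) * √(movement x z t) := by
  have hη := h.rate_pos ht
  have hD := h.D_nonneg
  have hc := h.c_pos
  have e1 : ‖x t - z t‖ ≤ √(movement x z t) :=
    Real.le_sqrt_of_sq_le (by unfold movement; nlinarith [sq_nonneg ‖z (t + 1) - x t‖])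
  have e2 : ‖z (t + 1) - x t‖ ≤ √(movement x z t) :=
    Real.le_sqrt_of_sq_le (by unfold movement; nlinarith [sq_nonneg ‖x t - z t‖])
  have e3 : ‖z (t + 1) - z t‖ ≤ 2 * √(movement x z t) := by
    have := norm_add_le (z (t + 1) - x t) (x t - z t)
    rw [sub_add_sub_cancel] at this
    linarith
  have hz := h.z_step t ht w hw
  have h1 : η t * ⟪u t, w - z (t + 1)⟫_ℝ ≤ 2 * √(movement x z t) * D := by
    have : η t * ⟪u t, w - z (t + 1)⟫_ℝ ≤ ⟪z (t + 1) - z t, w - z (t + 1)⟫_ℝ := by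
      rw [show z t + η t • u t - z (t + 1) = η t • u t - (z (t + 1) - z t) by abel,
        inner_sub_left, real_inner_smul_left] at hz
      linarith
    refine this.trans ((real_inner_le_norm _ _).trans ?_)
    exact mul_le_mul e3 (h.diam _ hw _ (h.z_mem _ (by omega))) (norm_nonneg _) (by positivity)
  have h2 : ⟪u t, w - z (t + 1)⟫_ℝ ≤ √(P (t + 1)) / c * (2 * √(movement x z t) * D) := by
    calc ⟪u t, w - z (t + 1)⟫_ℝ = (η t)⁻¹ * (η t * ⟪u t, w - z (t + 1)⟫_ℝ) := by field_simp
      _ ≤ (η t)⁻¹ * (2 * √(movement x z t) * D) := by gcongr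
      _ ≤ _ := by
        have := h.inv_rate_le ht
        gcongr
  have h3 : ⟪u t, z (t + 1) - x t⟫_ℝ ≤ G * √(movement x z t) :=
    (real_inner_le_norm _ _).trans (mul_le_mul (h.norm_u t ht) e2 (norm_nonneg _) h.G_nonneg)
  have h4 : ⟪u t, w - x t⟫_ℝ = ⟪u t, w - z (t + 1)⟫_ℝ + ⟪u t, z (t + 1) - x t⟫_ℝ := by
    rw [← inner_add_right, sub_add_sub_cancel]
  rw [h4]
  linarith

/-- If the prediction errors are controlled by the steps of a sequence `x'`, then `P` is controlled
by the movement of that sequence. -/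
lemma P_le_movement {F : Type*} [NormedAddCommGroup F] (h : AdaptiveRun K D G c δ x z u m P η)
    {x' z' : ℕ → F} {L : ℝ}
    (hL : ∀ t, 1 ≤ t → ‖u (t + 1) - m (t + 1)‖ ≤ L * ‖x' (t + 1) - x' t‖) {T : ℕ} (hT : 1 ≤ T) :
    P (T + 1) ≤ δ ^ 2 + 4 * L ^ 2 * ∑ t ∈ Finset.Icc 1 T, movement x' z' t := by
  suffices P (T + 1) ≤ δ ^ 2 + 4 * L ^ 2 * ∑ t ∈ Finset.Icc 1 T, movement x' z' t
      - 2 * L ^ 2 * movement x' z' T by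
    nlinarith [mul_nonneg (sq_nonneg L) (movement_nonneg x' z' T)]
  induction T, hT using Nat.le_induction with
  | base =>
    rw [h.P_two, Finset.Icc_self, Finset.sum_singleton]
    nlinarith [mul_nonneg (sq_nonneg L) (movement_nonneg x' z' 1)]
  | succ T hT ih =>
    rw [Finset.sum_Icc_succ_top (by omega), h.P_succ (T + 1) (by omega)]
    have h1 : ‖x' (T + 1) - x' T‖ ^ 2 ≤ 2 * (movement x' z' (T + 1) + movement x' z' T) := by
      have := norm_add_le (x' (T + 1) - z' (T + 1)) (z' (T + 1) - x' T)
      rw [sub_add_sub_cancel] at this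
      unfold movement
      nlinarith [pow_le_pow_left₀ (norm_nonneg _) this 2,
        sq_nonneg (‖x' (T + 1) - z' (T + 1)‖ - ‖z' (T + 1) - x' T‖),
        sq_nonneg ‖x' T - z' T‖, sq_nonneg ‖z' (T + 1 + 1) - x' (T + 1)‖]
    have h2 := pow_le_pow_left₀ (norm_nonneg _) (hL T hT) 2
    rw [mul_pow] at h2
    nlinarith [mul_le_mul_of_nonneg_left h1 (sq_nonneg L)]

end AdaptiveRun

/-- A sublinear self-bounding inequality for two coupled quantities gives a uniform bound. -/
lemma exists_bound_of_coupled {κ κ' δ δ' L : ℝ} (hκ : 0 < κ) (hκ' : 0 < κ') (hL : 0 < L)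
    (α α' : ℝ) : ∃ M : ℝ, ∀ q q' s s' : ℝ, 0 ≤ q → 0 ≤ q' →
      s ^ 2 ≤ δ ^ 2 + 4 * L ^ 2 * q' → s' ^ 2 ≤ δ' ^ 2 + 4 * L ^ 2 * q →
      κ * q + κ' * q' ≤ α * s + α' * s' → q ≤ M ∧ q' ≤ M := by
  have young : ∀ {μ : ℝ}, 0 < μ → ∀ a s : ℝ, a * s ≤ μ * s ^ 2 + a ^ 2 / (4 * μ) := by
    intro μ hμ a s
    have : 0 ≤ (2 * μ * s - a) ^ 2 / (4 * μ) := by positivity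
    have e : (2 * μ * s - a) ^ 2 / (4 * μ) = μ * s ^ 2 + a ^ 2 / (4 * μ) - a * s := by
      field_simp
      ring
    linarith
  set μ := κ' / (8 * L ^ 2) with hμ
  set μ' := κ / (8 * L ^ 2) with hμ'
  have hμ0 : 0 < μ := by positivity
  have hμ0' : 0 < μ' := by positivity
  have eμ : μ * (4 * L ^ 2) = κ' / 2 := by rw [hμ]; field_simp; norm_num
  have eμ' : μ' * (4 * L ^ 2) = κ / 2 := by rw [hμ']; field_simp; norm_num
  set B := μ * δ ^ 2 + α ^ 2 / (4 * μ) + μ' * δ' ^ 2 + α' ^ 2 / (4 * μ')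
  refine ⟨max (2 * B / κ) (2 * B / κ'), fun q q' s s' hq hq' hs hs' H => ?_⟩
  have b1 := young hμ0 α s
  have b2 := young hμ0' α' s'
  have b3 := mul_le_mul_of_nonneg_left hs hμ0.le
  have b4 := mul_le_mul_of_nonneg_left hs' hμ0'.le
  have b5 : μ * (δ ^ 2 + 4 * L ^ 2 * q') = μ * δ ^ 2 + κ' / 2 * q' := by rw [← eμ]; ring
  have b6 : μ' * (δ' ^ 2 + 4 * L ^ 2 * q) = μ' * δ' ^ 2 + κ / 2 * q := by rw [← eμ']; ring
  have b7 : κ * q + κ' * q' ≤ 2 * B := by linarith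
  have b8 := mul_nonneg hκ.le hq
  have b9 := mul_nonneg hκ'.le hq'
  constructor
  · exact le_max_of_le_left ((le_div_iff₀ hκ).2 (by linarith))
  · exact le_max_of_le_right ((le_div_iff₀ hκ').2 (by linarith))

section SelfPlay

variable {E F : Type*} [NormedAddCommGroup E] [InnerProductSpace ℝ E]
  [NormedAddCommGroup F] [InnerProductSpace ℝ F]

/-- The average of finitely many points of a convex set belongs to the set. -/
lemma Convex.inv_smul_sum_Icc_mem {K : Set E} (hK : Convex ℝ K) {x : ℕ → E}
    (hx : ∀ t, 1 ≤ t → x t ∈ K) {T : ℕ} (hT : 1 ≤ T) :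
    (T : ℝ)⁻¹ • ∑ t ∈ Finset.Icc 1 T, x t ∈ K := by
  rw [Finset.smul_sum]
  refine hK.sum_mem (fun _ _ => by positivity) ?_ fun t ht => hx t (Finset.mem_Icc.1 ht).1
  have : (T : ℝ) ≠ 0 := by positivity
  simp [this]

/-- Against the averages of play, the two regrets in a zero-sum game cancel. -/
lemma sum_regret_average_eq_zero (A : F →ₗ[ℝ] E) (B : E →ₗ[ℝ] F)
    (hAB : ∀ v w, ⟪A v, w⟫_ℝ = ⟪v, B w⟫_ℝ) (x : ℕ → E) (y : ℕ → F) {T : ℕ} :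
    ∑ t ∈ Finset.Icc 1 T, ⟪A (y t), (T : ℝ)⁻¹ • ∑ s ∈ Finset.Icc 1 T, x s - x t⟫_ℝ
      + ∑ t ∈ Finset.Icc 1 T, ⟪-B (x t), (T : ℝ)⁻¹ • ∑ s ∈ Finset.Icc 1 T, y s - y t⟫_ℝ = 0 := by
  have h1 : ∑ t ∈ Finset.Icc 1 T, ⟪A (y t), (T : ℝ)⁻¹ • ∑ s ∈ Finset.Icc 1 T, x s⟫_ℝ
      = ∑ t ∈ Finset.Icc 1 T, ⟪B (x t), (T : ℝ)⁻¹ • ∑ s ∈ Finset.Icc 1 T, y s⟫_ℝ := by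
    rw [← sum_inner, ← sum_inner, ← map_sum, ← map_sum, hAB, map_smul, inner_smul_right,
      inner_smul_right, real_inner_comm]
  have h2 : ∀ t, ⟪A (y t), x t⟫_ℝ = ⟪B (x t), y t⟫_ℝ := fun t => by
    rw [hAB, real_inner_comm]
  simp only [inner_sub_right, inner_neg_left, Finset.sum_sub_distrib, Finset.sum_neg_distrib, h1,
    h2]
  ring

/-- Best-iterate convergence of adaptive optimistic self-play in a bilinear zero-sum game. -/
theorem exists_iterate_gap_le {X : Set E} {Y : Set F} (hX : Convex ℝ X) (hY : Convex ℝ Y)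
    (A : F →ₗ[ℝ] E) (B : E →ₗ[ℝ] F) (hAB : ∀ v w, ⟪A v, w⟫_ℝ = ⟪v, B w⟫_ℝ)
    {L : ℝ} (hL : 0 < L) (hA : ∀ v, ‖A v‖ ≤ L * ‖v‖) (hB : ∀ v, ‖B v‖ ≤ L * ‖v‖)
    {x xt mX : ℕ → E} {y yt mY : ℕ → F} {uX : ℕ → E} {uY : ℕ → F}
    {DX GX cX δX DY GY cY δY : ℝ} {PX ηX PY ηY : ℕ → ℝ}
    (huX : ∀ t, 1 ≤ t → uX t = A (y t)) (huY : ∀ t, 1 ≤ t → uY t = -B (x t))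
    (hmX : ∀ t, 1 ≤ t → mX (t + 1) = uX t) (hmY : ∀ t, 1 ≤ t → mY (t + 1) = uY t)
    (rX : AdaptiveRun X DX GX cX δX x xt uX mX PX ηX)
    (rY : AdaptiveRun Y DY GY cY δY y yt uY mY PY ηY) (hPX : 0 ≤ PX 1) (hPY : 0 ≤ PY 1) :
    ∃ C : ℝ, 0 ≤ C ∧ ∀ T : ℕ, 1 ≤ T → ∃ t ∈ Finset.Icc 1 T, ∀ w ∈ X, ∀ v ∈ Y,
      ⟪uX t, w⟫_ℝ + ⟪uY t, v⟫_ℝ ≤ C / √T := by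
  have hLX : ∀ t, 1 ≤ t → ‖uX (t + 1) - mX (t + 1)‖ ≤ L * ‖y (t + 1) - y t‖ := fun t ht => by
    rw [hmX t ht, huX t ht, huX (t + 1) (by omega), ← map_sub]
    exact hA _
  have hLY : ∀ t, 1 ≤ t → ‖uY (t + 1) - mY (t + 1)‖ ≤ L * ‖x (t + 1) - x t‖ := fun t ht => by
    rw [hmY t ht, huY t ht, huY (t + 1) (by omega), neg_sub_neg, ← map_sub, norm_sub_rev]
    exact hB _
  have hcX := rX.c_pos
  have hcY := rY.c_pos
  have hδX := rX.δ_pos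
  have hδY := rY.δ_pos
  have hDX := rX.D_nonneg
  have hDY := rY.D_nonneg
  have hGX := rX.G_nonneg
  have hGY := rY.G_nonneg
  obtain ⟨M, hM⟩ := exists_bound_of_coupled (κ := δX / cX / 4) (κ' := δY / cY / 4) (δ := δX)
    (δ' := δY) (by positivity) (by positivity) hL
    (DX ^ 2 / (2 * cX) + cX * (2 + 2 * GX / δX)) (DY ^ 2 / (2 * cY) + cY * (2 + 2 * GY / δY))
  have hbound : ∀ T, 1 ≤ T → ∑ t ∈ Finset.Icc 1 T, movement x xt t ≤ M ∧
      ∑ t ∈ Finset.Icc 1 T, movement y yt t ≤ M := by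
    intro T hT
    have h1 := rX.regret_le hPX (hX.inv_smul_sum_Icc_mem rX.x_mem hT) hT
    have h2 := rY.regret_le hPY (hY.inv_smul_sum_Icc_mem rY.x_mem hT) hT
    have h3 := sum_regret_average_eq_zero A B hAB x y (T := T)
    rw [Finset.sum_congr rfl fun t ht => by rw [huX t (Finset.mem_Icc.1 ht).1]] at h1
    rw [Finset.sum_congr rfl fun t ht => by rw [huY t (Finset.mem_Icc.1 ht).1]] at h2
    refine hM _ _ √(PX (T + 1)) √(PY (T + 1))
      (Finset.sum_nonneg fun t _ => movement_nonneg x xt t)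
      (Finset.sum_nonneg fun t _ => movement_nonneg y yt t) ?_ ?_ (by linarith)
    · rw [Real.sq_sqrt ((sq_nonneg _).trans (rX.sq_le_P (by omega)))]
      exact rX.P_le_movement hLX hT
    · rw [Real.sq_sqrt ((sq_nonneg _).trans (rY.sq_le_P (by omega)))]
      exact rY.P_le_movement hLY hT
  set CX := √(δX ^ 2 + 4 * L ^ 2 * M) / cX * (2 * DX) + GX
  set CY := √(δY ^ 2 + 4 * L ^ 2 * M) / cY * (2 * DY) + GY
  have hCX : 0 ≤ CX := by positivity
  have hCY : 0 ≤ CY := by positivity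
  refine ⟨(CX + CY) * √(2 * M), by positivity, fun T hT => ?_⟩
  have hT0 : (0 : ℝ) < T := by exact_mod_cast hT
  obtain ⟨t, ht, hmin⟩ : ∃ t ∈ Finset.Icc 1 T, movement x xt t + movement y yt t ≤ 2 * M / T := by
    refine Finset.exists_le_of_sum_le (Finset.nonempty_Icc.2 hT) ?_
    rw [Finset.sum_add_distrib, Finset.sum_const, Nat.card_Icc, nsmul_eq_mul,
      Nat.add_sub_cancel, mul_div_cancel₀ _ hT0.ne']
    linarith [hbound T hT]
  refine ⟨t, ht, fun w hw v hv => ?_⟩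
  have ht := (Finset.mem_Icc.1 ht).1
  have hPXt : √(PX (t + 1)) ≤ √(δX ^ 2 + 4 * L ^ 2 * M) := by
    refine Real.sqrt_le_sqrt ((rX.P_le_movement (z' := yt) hLX ht).trans ?_)
    have := (hbound t ht).2
    gcongr
  have hPYt : √(PY (t + 1)) ≤ √(δY ^ 2 + 4 * L ^ 2 * M) := by
    refine Real.sqrt_le_sqrt ((rY.P_le_movement (z' := xt) hLY ht).trans ?_)
    have := (hbound t ht).1
    gcongr
  have gX : ⟪uX t, w - x t⟫_ℝ ≤ CX * √(2 * M / T) := by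
    refine (rX.inner_le_movement hw ht).trans ?_
    have : movement x xt t ≤ 2 * M / T := by linarith [movement_nonneg y yt t]
    have hle : √(PX (t + 1)) / cX * (2 * DX) + GX ≤ CX := by
      simp only [CX]
      gcongr
    gcongr
  have gY : ⟪uY t, v - y t⟫_ℝ ≤ CY * √(2 * M / T) := by
    refine (rY.inner_le_movement hv ht).trans ?_
    have : movement y yt t ≤ 2 * M / T := by linarith [movement_nonneg x xt t]
    have hle : √(PY (t + 1)) / cY * (2 * DY) + GY ≤ CY := by
      simp only [CY]
      gcongr
    gcongr
  have hzero : ⟪uX t, x t⟫_ℝ + ⟪uY t, y t⟫_ℝ = 0 := by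
    rw [huX t ht, huY t ht, hAB, inner_neg_left, real_inner_comm, add_neg_cancel]
  rw [inner_sub_right] at gX gY
  have hM0 : 0 ≤ 2 * M := by
    have := (Finset.sum_nonneg fun t _ => movement_nonneg x xt t).trans (hbound T hT).1
    linarith
  rw [mul_div_assoc, ← Real.sqrt_div hM0]
  linarith

end SelfPlay

section Coordinates

lemma l2_eq_norm {d : ℕ} (v : Fin d → ℝ) : l2 v = ‖WithLp.toLp 2 v‖ := by
  simp [l2, EuclideanSpace.norm_eq]

lemma dotp_eq_inner {d : ℕ} (v w : Fin d → ℝ) :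
    dotp v w = ⟪WithLp.toLp 2 v, WithLp.toLp 2 w⟫_ℝ := by
  simp [dotp, PiLp.inner_apply, mul_comm]

lemma Convex.toLp_image {d : ℕ} {K : Set (Fin d → ℝ)} (hK : Convex ℝ K) :
    Convex ℝ (WithLp.toLp 2 '' K) :=
  hK.linear_image (WithLp.linearEquiv 2 ℝ (Fin d → ℝ)).symm.toLinearMap

lemma inner_toLp_le_zero_of_closest {d : ℕ} {K : Set (Fin d → ℝ)} (hK : Convex ℝ K)
    {p q : Fin d → ℝ} (hp : p ∈ K ∧ ∀ w ∈ K, l2 (p - q) ≤ l2 (w - q))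
    {w : EuclideanSpace ℝ (Fin d)} (hw : w ∈ WithLp.toLp 2 '' K) :
    ⟪WithLp.toLp 2 q - WithLp.toLp 2 p, w - WithLp.toLp 2 p⟫_ℝ ≤ 0 := by
  refine inner_sub_le_zero_of_closest hK.toLp_image ⟨p, hp.1, rfl⟩ ?_ hw
  rintro _ ⟨v, hv, rfl⟩
  simpa only [l2_eq_norm, WithLp.toLp_sub] using hp.2 v hv

lemma exists_norm_toLp_le {d : ℕ} {S : Set (Fin d → ℝ)} (hS : IsCompact S) :
    ∃ G : ℝ, 0 ≤ G ∧ ∀ v ∈ S, ‖WithLp.toLp 2 v‖ ≤ G := by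
  obtain ⟨G, hG0, hG⟩ :=
    (hS.image (PiLp.continuous_toLp 2 fun _ : Fin d => ℝ)).isBounded.exists_pos_norm_le
  exact ⟨G, hG0.le, fun v hv => hG _ ⟨v, hv, rfl⟩⟩

lemma eq_one_or_eq_succ {t : ℕ} (ht : 1 ≤ t) : t = 1 ∨ ∃ s, 1 ≤ s ∧ t = s + 1 := by
  rcases ht.eq_or_lt with h | h
  · exact .inl h.symm
  · exact .inr ⟨t - 1, by omega, by omega⟩

/-- The dynamics in coordinates form an adaptive run in Euclidean space. -/
lemma exists_adaptiveRun {d : ℕ} {K S : Set (Fin d → ℝ)} (hK : Convex ℝ K) (hKc : IsCompact K)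
    (hS : IsCompact S) {x z u m : ℕ → Fin d → ℝ} {P η : ℕ → ℝ} {c : ℝ} (hc : 0 < c)
    (hu : ∀ t, 1 ≤ t → u t ∈ S) (hm1 : m 1 = 0) (hm : ∀ t, 2 ≤ t → m t = u (t - 1))
    (hP : ∀ t, P t = ∑ τ ∈ Finset.Icc 1 (t - 1), (l2 (u τ - m τ)) ^ 2)
    (hη : ∀ t, 2 ≤ t → η t = c / √(P t)) (hη1 : η 1 = η 2)
    (hx1 : x 1 = z 1) (hz1 : z 1 ∈ K)
    (hz : ∀ t, 1 ≤ t → z (t + 1) ∈ K ∧ ∀ w ∈ K,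
      l2 (z (t + 1) - (z t + η t • u t)) ≤ l2 (w - (z t + η t • u t)))
    (hx : ∀ t, 1 ≤ t → x (t + 1) ∈ K ∧ ∀ w ∈ K,
      l2 (x (t + 1) - (z (t + 1) + η (t + 1) • m (t + 1)))
        ≤ l2 (w - (z (t + 1) + η (t + 1) • m (t + 1))))
    (hδ : 0 < l2 (u 1)) :
    ∃ D G : ℝ, AdaptiveRun (WithLp.toLp 2 '' K) D G c (l2 (u 1)) (fun t => WithLp.toLp 2 (x t))
      (fun t => WithLp.toLp 2 (z t)) (fun t => WithLp.toLp 2 (u t))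
      (fun t => WithLp.toLp 2 (m t)) P η := by
  obtain ⟨R, -, hR⟩ := exists_norm_toLp_le hKc
  obtain ⟨G, hG0, hG⟩ := exists_norm_toLp_le hS
  refine ⟨2 * R, G, ?_, fun t ht => hG _ (hu t ht), fun t ht => ?_, hc, hδ, fun t ht => ?_,
    fun t ht => ?_, fun t ht w hw => ?_, fun t ht w hw => ?_, ?_, fun t ht => ?_, hη, hη1⟩
  · rintro _ ⟨v, hv, rfl⟩ _ ⟨w, hw, rfl⟩
    linarith [norm_sub_le (WithLp.toLp 2 v) (WithLp.toLp 2 w), hR v hv, hR w hw]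
  · rcases ht.eq_or_lt with rfl | ht
    · simpa [hm1] using hG0
    · rw [hm t ht]
      exact hG _ (hu _ (by omega))
  · obtain rfl | ⟨s, hs, rfl⟩ := eq_one_or_eq_succ ht
    · exact ⟨_, hx1 ▸ hz1, rfl⟩
    · exact ⟨_, (hx s hs).1, rfl⟩
  · obtain rfl | ⟨s, hs, rfl⟩ := eq_one_or_eq_succ ht
    · exact ⟨_, hz1, rfl⟩
    · exact ⟨_, (hz s hs).1, rfl⟩
  · simpa only [WithLp.toLp_add, WithLp.toLp_smul] using
      inner_toLp_le_zero_of_closest hK (hz t ht) hw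
  · obtain rfl | ⟨s, hs, rfl⟩ := eq_one_or_eq_succ ht
    · simp [hm1, hx1]
    · simpa only [WithLp.toLp_add, WithLp.toLp_smul] using
        inner_toLp_le_zero_of_closest hK (hx s hs) hw
  · rw [hP]
    simp [hm1]
  · rw [hP, hP, ← WithLp.toLp_sub, ← l2_eq_norm]
    obtain ⟨s, rfl⟩ : ∃ s, t = s + 1 := ⟨t - 1, by omega⟩
    simp only [Nat.add_sub_cancel]
    rw [Finset.sum_Icc_succ_top (by omega)]

lemma exists_norm_le_mul {E F : Type*} [NormedAddCommGroup E] [NormedSpace ℝ E]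
    [FiniteDimensional ℝ E] [NormedAddCommGroup F] [NormedSpace ℝ F] (A : E →ₗ[ℝ] F) :
    ∃ L : ℝ, 0 < L ∧ ∀ v, ‖A v‖ ≤ L * ‖v‖ := by
  refine ⟨‖A.toContinuousLinearMap‖ + 1, by positivity, fun v => ?_⟩
  have := A.toContinuousLinearMap.le_opNorm v
  simp only [LinearMap.coe_toContinuousLinearMap'] at this
  linarith [norm_nonneg v]

lemma inner_toLpLin_transpose {m n : ℕ} (A : Matrix (Fin m) (Fin n) ℝ)
    (v : EuclideanSpace ℝ (Fin n)) (w : EuclideanSpace ℝ (Fin m)) :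
    ⟪Matrix.toLpLin 2 2 A v, w⟫_ℝ = ⟪v, Matrix.toLpLin 2 2 Aᵀ w⟫_ℝ := by
  rw [Matrix.toLpLin_apply, Matrix.toLpLin_apply, EuclideanSpace.inner_eq_star_dotProduct,
    EuclideanSpace.inner_eq_star_dotProduct]
  simp [Matrix.dotProduct_mulVec, Matrix.mulVec_transpose]

end Coordinates

/-- in self-play AdOGD on a zero-sum game, there is a constant
`C ≥ 0` (independent of `T`) such that for every horizon `T ≥ 1` some iterate
`t ∈ {1,…,T}` has duality gap at most `C / √T`. -/
theorem stmt6
    {m n : ℕ} (A : Matrix (Fin m) (Fin n) ℝ)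
    (X : Set (Fin m → ℝ)) (Y : Set (Fin n → ℝ))
    (hXne : X.Nonempty) (hXconv : Convex ℝ X) (hXcomp : IsCompact X)
    (hYne : Y.Nonempty) (hYconv : Convex ℝ Y) (hYcomp : IsCompact Y)
    -- iterates and utilities
    (x xt : ℕ → Fin m → ℝ) (y yt : ℕ → Fin n → ℝ)
    (uX mX : ℕ → Fin m → ℝ) (uY mY : ℕ → Fin n → ℝ)
    (huX : ∀ t, 1 ≤ t → uX t = A *ᵥ y t)
    (huY : ∀ t, 1 ≤ t → uY t = -(Aᵀ *ᵥ x t))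
    (hmX1 : mX 1 = 0) (hmX : ∀ t, 2 ≤ t → mX t = uX (t - 1))
    (hmY1 : mY 1 = 0) (hmY : ∀ t, 2 ≤ t → mY t = uY (t - 1))
    -- adaptive learning rates
    (ηXc ηYc : ℝ) (hηXc : 0 < ηXc) (hηYc : 0 < ηYc)
    (PX PY : ℕ → ℝ)
    (hPX : ∀ t, PX t = ∑ τ ∈ Finset.Icc 1 (t - 1), (l2 (uX τ - mX τ)) ^ 2)
    (hPY : ∀ t, PY t = ∑ τ ∈ Finset.Icc 1 (t - 1), (l2 (uY τ - mY τ)) ^ 2)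
    (ηX ηY : ℕ → ℝ)
    (hηX : ∀ t, 2 ≤ t → ηX t = ηXc / Real.sqrt (PX t)) (hηX1 : ηX 1 = ηX 2)
    (hηY : ∀ t, 2 ≤ t → ηY t = ηYc / Real.sqrt (PY t)) (hηY1 : ηY 1 = ηY 2)
    -- AdOGD dynamics (projections encoded by the closest-point property)
    (hx1 : x 1 = xt 1) (hxt1 : xt 1 ∈ X)
    (hy1 : y 1 = yt 1) (hyt1 : yt 1 ∈ Y)
    (hxtproj : ∀ t, 1 ≤ t → xt (t + 1) ∈ X ∧ ∀ w ∈ X,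
        l2 (xt (t + 1) - (xt t + ηX t • uX t)) ≤ l2 (w - (xt t + ηX t • uX t)))
    (hxproj : ∀ t, 1 ≤ t → x (t + 1) ∈ X ∧ ∀ w ∈ X,
        l2 (x (t + 1) - (xt (t + 1) + ηX (t + 1) • mX (t + 1)))
          ≤ l2 (w - (xt (t + 1) + ηX (t + 1) • mX (t + 1))))
    (hytproj : ∀ t, 1 ≤ t → yt (t + 1) ∈ Y ∧ ∀ w ∈ Y,
        l2 (yt (t + 1) - (yt t + ηY t • uY t)) ≤ l2 (w - (yt t + ηY t • uY t)))
    (hyproj : ∀ t, 1 ≤ t → y (t + 1) ∈ Y ∧ ∀ w ∈ Y,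
        l2 (y (t + 1) - (yt (t + 1) + ηY (t + 1) • mY (t + 1)))
          ≤ l2 (w - (yt (t + 1) + ηY (t + 1) • mY (t + 1))))
    (δX δY : ℝ) (hδX : δX = l2 (uX 1)) (hδY : δY = l2 (uY 1))
    (hδXpos : 0 < δX) (hδYpos : 0 < δY)
    :
    ∃ C : ℝ, 0 ≤ C ∧ ∀ T : ℕ, 1 ≤ T → ∃ t ∈ Finset.Icc 1 T,
      sSup ((fun xs : Fin m → ℝ => dotp xs (A *ᵥ y t)) '' X)
        - sInf ((fun ys : Fin n → ℝ => dotp (Aᵀ *ᵥ x t) ys) '' Y)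
        ≤ C / Real.sqrt T := by
  have hxmem : ∀ t, 1 ≤ t → x t ∈ X := fun t ht => by
    obtain rfl | ⟨s, hs, rfl⟩ := eq_one_or_eq_succ ht
    exacts [hx1 ▸ hxt1, (hxproj s hs).1]
  have hymem : ∀ t, 1 ≤ t → y t ∈ Y := fun t ht => by
    obtain rfl | ⟨s, hs, rfl⟩ := eq_one_or_eq_succ ht
    exacts [hy1 ▸ hyt1, (hyproj s hs).1]
  obtain ⟨DX, GX, rX⟩ := exists_adaptiveRun hXconv hXcomp
    (hYcomp.image (f := fun v => A *ᵥ v) (by fun_prop)) hηXc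
    (fun t ht => ⟨y t, hymem t ht, (huX t ht).symm⟩) hmX1 hmX hPX hηX hηX1 hx1 hxt1 hxtproj hxproj
    (hδX ▸ hδXpos)
  obtain ⟨DY, GY, rY⟩ := exists_adaptiveRun hYconv hYcomp
    (hXcomp.image (f := fun v => -(Aᵀ *ᵥ v)) (by fun_prop)) hηYc
    (fun t ht => ⟨x t, hxmem t ht, (huY t ht).symm⟩) hmY1 hmY hPY hηY hηY1 hy1 hyt1 hytproj hyproj
    (hδY ▸ hδYpos)
  obtain ⟨L, hL, hA⟩ := exists_norm_le_mul (Matrix.toLpLin 2 2 A)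
  obtain ⟨L', hL', hB⟩ := exists_norm_le_mul (Matrix.toLpLin 2 2 Aᵀ)
  obtain ⟨C, hC, H⟩ := exists_iterate_gap_le hXconv.toLp_image hYconv.toLp_image
    (Matrix.toLpLin 2 2 A) (Matrix.toLpLin 2 2 Aᵀ) (inner_toLpLin_transpose A)
    (lt_max_of_lt_left hL : 0 < max L L')
    (fun v => (hA v).trans (by gcongr; exact le_max_left _ _))
    (fun v => (hB v).trans (by gcongr; exact le_max_right _ _))
    (fun t ht => by simp only [huX t ht, Matrix.toLpLin_toLp, Matrix.toLin'_apply])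
    (fun t ht => by
      simp only [huY t ht, Matrix.toLpLin_toLp, Matrix.toLin'_apply, WithLp.toLp_neg])
    (fun t ht => by simp only [hmX (t + 1) (by omega), Nat.add_sub_cancel])
    (fun t ht => by simp only [hmY (t + 1) (by omega), Nat.add_sub_cancel])
    rX rY (by simp [hPX]) (by simp [hPY])
  refine ⟨C, hC, fun T hT => ?_⟩
  obtain ⟨t, ht, hgap⟩ := H T hT
  refine ⟨t, ht, ?_⟩
  rw [sub_le_iff_le_add]
  refine csSup_le (hXne.image _) ?_
  rintro _ ⟨w, hw, rfl⟩
  rw [← sub_le_iff_le_add']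
  refine le_csInf (hYne.image _) ?_
  rintro _ ⟨v, hv, rfl⟩
  have hwv := hgap _ ⟨w, hw, rfl⟩ _ ⟨v, hv, rfl⟩
  have ht := (Finset.mem_Icc.1 ht).1
  rw [← dotp_eq_inner, ← dotp_eq_inner, huX t ht, huY t ht] at hwv
  have e1 : dotp (A *ᵥ y t) w = dotp w (A *ᵥ y t) := by simp only [dotp, mul_comm]
  have e2 : dotp (-(Aᵀ *ᵥ x t)) v = -dotp (Aᵀ *ᵥ x t) v := by simp [dotp]
  simp only
  linarith
end

section
/- Let r, r̃ ∈ ℝⁿ satisfy ‖[r]⁺‖₂ = ‖[r̃]⁺‖₂. Then ⟨[r]⁺ − r̃, [r]⁺⟩ ≥ (1/2) ‖[r]⁺ − [r̃]⁺‖₂². -/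
/-- Coordinatewise positive part `[v]⁺`. -/
def ppart {d : ℕ} (v : Fin d → ℝ) : Fin d → ℝ := fun i => max (v i) 0

/-- if `‖[r]⁺‖₂ = ‖[r̃]⁺‖₂` then
`⟨[r]⁺ - r̃, [r]⁺⟩ ≥ (1/2) ‖[r]⁺ - [r̃]⁺‖₂²`. -/
theorem stmt9 {n : ℕ} (r rtil : Fin n → ℝ)
    (h : l2 (ppart r) = l2 (ppart rtil)) :
    (1 / 2) * (l2 (ppart r - ppart rtil)) ^ 2 ≤ dotp (ppart r - rtil) (ppart r) := by
  have hsq : ∑ i, (ppart r i) ^ 2 = ∑ i, (ppart rtil i) ^ 2 :=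
    (Real.sqrt_inj (Finset.sum_nonneg fun i _ => sq_nonneg _)
      (Finset.sum_nonneg fun i _ => sq_nonneg _)).1 h
  have hterm : ∑ i, ((ppart r - ppart rtil) i ^ 2 + (ppart r i ^ 2 - ppart rtil i ^ 2)) ≤
      ∑ i, 2 * ((ppart r - rtil) i * ppart r i) := by
    refine Finset.sum_le_sum fun i _ => ?_
    have hr : 0 ≤ ppart r i := le_max_right _ _
    have hrtil : rtil i ≤ ppart rtil i := le_max_left _ _
    simp only [Pi.sub_apply]
    nlinarith [mul_le_mul_of_nonneg_right hrtil hr]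
  rw [Finset.sum_add_distrib, Finset.sum_sub_distrib, ← Finset.mul_sum] at hterm
  rw [l2, Real.sq_sqrt (Finset.sum_nonneg fun i _ => sq_nonneg _), dotp]
  linarith
end
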